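/- arXiv:1709.03230 — 3 statements merged into one kernel-verified Lean document; each statement's English description precedes it below -/
import Mathlib

section
/- Let p be an integer and q a positive even integer with gcd(p, q) = 1, and work in the group of bijections of ℝ². Let t₁(x, y) = (x + 1, y), t₂(x, y) = (x, y + 1), let g̃(x, y) = (x + p/q, −y), and let a(x, y) = (x + 1/q, −y). Then the subgroup generated by {t₁, t₂, g̃} equals the subgroup generated by {a, t₂}; moreover a ∘ t₂ ∘ a⁻¹ = t₂⁻¹, so this group is generated by two elements satisfying the Klein bottle relation. -/
/-- Integer powers of the horizontal glide reflection with translation length `c`. -/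
lemma glide_zpow_apply (c : ℝ) (a : Equiv.Perm (ℝ × ℝ))
    (ha : ∀ z : ℝ × ℝ, a z = (z.1 + c, -z.2)) (n : ℤ) (z : ℝ × ℝ) :
    (a ^ n) z = (z.1 + n * c, (-1 : ℝ) ^ n * z.2) := by
  have ha_inv (z : ℝ × ℝ) : a⁻¹ z = (z.1 - c, -z.2) := by
    rw [Equiv.Perm.inv_eq_iff_eq, ha]
    simp
  induction n generalizing z with
  | zero => simp
  | succ n ih =>
    rw [zpow_add_one, Equiv.Perm.mul_apply, ha, ih, zpow_add_one₀ (by norm_num)]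
    ext <;> push_cast <;> ring
  | pred n ih =>
    rw [zpow_sub_one, Equiv.Perm.mul_apply, ha_inv, ih, zpow_sub_one₀ (by norm_num)]
    ext <;> push_cast <;> ring


/-- For `q` even, in the group of bijections of `ℝ²`, the subgroup generated by the
integer translations `t₁, t₂` and the glide reflection `g̃(x, y) = (x + p/q, -y)`
equals the subgroup generated by `a(x, y) = (x + 1/q, -y)` and `t₂`; moreover
`a ∘ t₂ ∘ a⁻¹ = t₂⁻¹`, so this group is generated by two elements satisfying the
Klein bottle relation. -/
theorem glide_lattice_group_even (p : ℤ) (q : ℕ) (hq : 0 < q) (hqe : Even q)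
    (hpq : Int.gcd p (q : ℤ) = 1)
    (t₁ t₂ g a : Equiv.Perm (ℝ × ℝ))
    (ht₁ : ∀ z : ℝ × ℝ, t₁ z = (z.1 + 1, z.2))
    (ht₂ : ∀ z : ℝ × ℝ, t₂ z = (z.1, z.2 + 1))
    (hg : ∀ z : ℝ × ℝ, g z = (z.1 + (p : ℝ) / (q : ℝ), -z.2))
    (ha : ∀ z : ℝ × ℝ, a z = (z.1 + 1 / (q : ℝ), -z.2)) :
    Subgroup.closure {t₁, t₂, g} = Subgroup.closure {a, t₂} ∧ a * t₂ * a⁻¹ = t₂⁻¹ := by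
  have hq₀ : (q : ℝ) ≠ 0 := by positivity
  have hp : Odd p := by
    rw [← Int.not_even_iff_odd, even_iff_two_dvd]
    intro h
    have h₂ := Int.dvd_coe_gcd h (Int.natCast_dvd_natCast.2 hqe.two_dvd)
    rw [hpq] at h₂
    norm_num at h₂
  have hat : a ^ (q : ℤ) = t₁ := by
    ext1 z
    rw [glide_zpow_apply _ a ha, ht₁, Even.neg_one_zpow (by exact_mod_cast hqe)]
    simp [hq₀]
  have hag : a ^ p = g := by
    ext1 z
    rw [glide_zpow_apply _ a ha, hg, Odd.neg_one_zpow hp]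
    simp [div_eq_mul_inv]
  refine ⟨le_antisymm ?_ ?_, ?_⟩
  · have hmem : a ∈ Subgroup.closure {a, t₂} := Subgroup.subset_closure (by simp)
    rw [Subgroup.closure_le]
    rintro x (rfl | rfl | rfl)
    · exact hat ▸ zpow_mem hmem _
    · exact Subgroup.subset_closure (by simp)
    · exact hag ▸ zpow_mem hmem _
  · rw [Subgroup.closure_le]
    rintro x (rfl | rfl)
    · have hx : x = g ^ p.gcdA q * t₁ ^ p.gcdB q := by
        rw [← hag, ← hat, ← zpow_mul, ← zpow_mul, ← zpow_add, ← Int.gcd_eq_gcd_ab, hpq]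
        simp
      rw [SetLike.mem_coe, hx]
      exact mul_mem (zpow_mem (Subgroup.subset_closure (by simp)) _)
        (zpow_mem (Subgroup.subset_closure (by simp)) _)
    · exact Subgroup.subset_closure (by simp)
  · rw [mul_inv_eq_iff_eq_mul, eq_inv_mul_iff_mul_eq]
    ext1 z
    simp [ha, ht₂]
end

section
/- Let p be an integer and q a positive odd integer with gcd(p, q) = 1, and work in the group of bijections of ℝ². Let t₁(x, y) = (x + 1, y), t₂(x, y) = (x, y + 1), let g̃(x, y) = (x + p/q, −y), let u(x, y) = (x + 1/q, y), and let ρ(x, y) = (x, −y). Then the subgroup generated by {t₁, t₂, g̃} equals the subgroup generated by {u, t₂, ρ}. -/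
/-- Let `u` commute with an involution `ρ`. If `p` is coprime to the odd number `q`, then
`u ^ q` and `u ^ p * ρ` generate, together with any `s`, the same subgroup as `u` and `ρ`. -/
theorem closure_pow_zpow_mul_involution_eq {G : Type*} [Group G] {p : ℤ} {q : ℕ} (hqo : Odd q)
    (hpq : Int.gcd p (q : ℤ) = 1) {u ρ : G} (s : G) (hc : Commute u ρ) (hρ : ρ ^ 2 = 1) :
    Subgroup.closure {u ^ q, s, u ^ p * ρ} = Subgroup.closure {u, s, ρ} := by
  apply le_antisymm
  · have hu : u ∈ Subgroup.closure {u, s, ρ} := Subgroup.subset_closure (by simp)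
    have hs : s ∈ Subgroup.closure {u, s, ρ} := Subgroup.subset_closure (by simp)
    have hr : ρ ∈ Subgroup.closure {u, s, ρ} := Subgroup.subset_closure (by simp)
    rw [Subgroup.closure_le]
    rintro x (rfl | rfl | rfl)
    · exact pow_mem hu q
    · exact hs
    · exact mul_mem (zpow_mem hu p) hr
  · set H := Subgroup.closure {u ^ q, s, u ^ p * ρ} with hH
    have ht : u ^ q ∈ H := Subgroup.subset_closure (by simp)
    have hs : s ∈ H := Subgroup.subset_closure (by simp)
    have hg : u ^ p * ρ ∈ H := Subgroup.subset_closure (by simp)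
    have hρq : ρ ^ q = ρ := by
      obtain ⟨k, rfl⟩ := hqo
      rw [pow_succ, pow_mul, hρ, one_pow, one_mul]
    have hgq : (u ^ p * ρ) ^ q = (u ^ q) ^ p * ρ := by
      rw [(hc.zpow_left p).mul_pow, hρq, ← zpow_natCast, ← zpow_natCast, ← zpow_mul, ← zpow_mul,
        mul_comm]
    have hr : ρ ∈ H := by
      have h := pow_mem hg q
      rw [hgq] at h
      exact (H.mul_mem_cancel_left (zpow_mem ht p)).1 h
    have hup : u ^ p ∈ H := (H.mul_mem_cancel_right hr).1 hg
    have hu : u ∈ H := by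
      have hbez := Int.gcd_eq_gcd_ab p q
      rw [hpq] at hbez
      have h : u = (u ^ p) ^ Int.gcdA p q * (u ^ q) ^ Int.gcdB p q := by
        rw [← zpow_natCast u q, ← zpow_mul, ← zpow_mul, ← zpow_add, ← hbez]
        simp
      rw [h]
      exact mul_mem (zpow_mem hup _) (zpow_mem ht _)
    rw [Subgroup.closure_le]
    rintro x (rfl | rfl | rfl)
    exacts [hu, hs, hr]

/-- Integer powers of a horizontal translation of the plane. -/
theorem zpow_apply_of_horizontal_translation {u : Equiv.Perm (ℝ × ℝ)} {c : ℝ}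
    (hu : ∀ z : ℝ × ℝ, u z = (z.1 + c, z.2)) (n : ℤ) (z : ℝ × ℝ) :
    (u ^ n) z = (z.1 + n * c, z.2) := by
  induction n generalizing z with
  | zero => simp
  | succ k ih =>
    rw [zpow_add_one, Equiv.Perm.mul_apply, ih, hu]
    ext <;> push_cast <;> ring
  | pred k ih =>
    rw [zpow_sub_one, Equiv.Perm.mul_apply, ih]
    have h : u⁻¹ z = (z.1 - c, z.2) := by
      rw [Equiv.Perm.inv_eq_iff_eq, hu]
      simp
    rw [h]
    ext <;> push_cast <;> ring

/-- For `q` odd, in the group of bijections of `ℝ²`, the subgroup generated by the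
integer translations `t₁, t₂` and the glide reflection `g̃(x, y) = (x + p/q, -y)`
equals the subgroup generated by the translation `u(x, y) = (x + 1/q, y)`, `t₂`
and the reflection `ρ(x, y) = (x, -y)`. -/
theorem glide_lattice_group_odd (p : ℤ) (q : ℕ) (hq : 0 < q) (hqo : Odd q)
    (hpq : Int.gcd p (q : ℤ) = 1)
    (t₁ t₂ g u ρ : Equiv.Perm (ℝ × ℝ))
    (ht₁ : ∀ z : ℝ × ℝ, t₁ z = (z.1 + 1, z.2))
    (ht₂ : ∀ z : ℝ × ℝ, t₂ z = (z.1, z.2 + 1))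
    (hg : ∀ z : ℝ × ℝ, g z = (z.1 + (p : ℝ) / (q : ℝ), -z.2))
    (hu : ∀ z : ℝ × ℝ, u z = (z.1 + 1 / (q : ℝ), z.2))
    (hρ : ∀ z : ℝ × ℝ, ρ z = (z.1, -z.2)) :
    Subgroup.closure {t₁, t₂, g} = Subgroup.closure {u, t₂, ρ} := by
  have ht : t₁ = u ^ q := by
    ext1 z
    rw [← zpow_natCast, zpow_apply_of_horizontal_translation hu, ht₁]
    have hq' : (q : ℝ) ≠ 0 := by exact_mod_cast hq.ne'
    simp [hq']
  have hgu : g = u ^ p * ρ := by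
    ext1 z
    rw [Equiv.Perm.mul_apply, zpow_apply_of_horizontal_translation hu, hg, hρ, mul_one_div]
  have hc : Commute u ρ := by
    ext1 z
    simp only [Equiv.Perm.mul_apply, hu, hρ]
  have hρ2 : ρ ^ 2 = 1 := by
    ext1 z
    simp [pow_two, hρ]
  rw [ht, hgu]
  exact closure_pow_zpow_mul_involution_eq hqo hpq t₂ hc hρ2
end

section
/- Let p be an integer and q a positive odd integer with gcd(p, q) = 1, and work in the group of bijections of ℝ². Let t₁(x, y) = (x + 1, y), t₂(x, y) = (x, y + 1), let h̃(x, y) = (y + p/q, x + p/q), let w(x, y) = (x + 1/q, y + 1/q), and let σ(x, y) = (y, x). Then the subgroup generated by {t₁, t₂, h̃} equals the subgroup generated by {w, t₂, σ}. -/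
/-- Integer powers of a translation of the plane are translations by the integer multiples. -/
theorem zpow_apply_of_translation {f : Equiv.Perm (ℝ × ℝ)} {a b : ℝ}
    (hf : ∀ z : ℝ × ℝ, f z = (z.1 + a, z.2 + b)) (n : ℤ) (z : ℝ × ℝ) :
    (f ^ n) z = (z.1 + n * a, z.2 + n * b) := by
  induction n generalizing z with
  | zero => simp
  | succ n ih =>
    rw [zpow_add_one, Equiv.Perm.mul_apply, hf, ih]
    ext <;> push_cast <;> ring
  | pred n ih =>
    have hinv : f⁻¹ z = (z.1 - a, z.2 - b) := by
      rw [Equiv.Perm.inv_eq_iff_eq, hf]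
      simp
    rw [zpow_sub_one, Equiv.Perm.mul_apply, hinv, ih]
    ext <;> push_cast <;> ring


/-- For `q` odd, in the group of bijections of `ℝ²`, the subgroup generated by the
integer translations `t₁, t₂` and the diagonal glide reflection
`h̃(x, y) = (y + p/q, x + p/q)` equals the subgroup generated by the diagonal
translation `w(x, y) = (x + 1/q, y + 1/q)`, `t₂` and the swap `σ(x, y) = (y, x)`. -/
theorem dglide_lattice_group_odd (p : ℤ) (q : ℕ) (hq : 0 < q) (hqo : Odd q)
    (hpq : Int.gcd p (q : ℤ) = 1)
    (t₁ t₂ h w σ : Equiv.Perm (ℝ × ℝ))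
    (ht₁ : ∀ z : ℝ × ℝ, t₁ z = (z.1 + 1, z.2))
    (ht₂ : ∀ z : ℝ × ℝ, t₂ z = (z.1, z.2 + 1))
    (hh : ∀ z : ℝ × ℝ, h z = (z.2 + (p : ℝ) / (q : ℝ), z.1 + (p : ℝ) / (q : ℝ)))
    (hw : ∀ z : ℝ × ℝ, w z = (z.1 + 1 / (q : ℝ), z.2 + 1 / (q : ℝ)))
    (hσ : ∀ z : ℝ × ℝ, σ z = (z.2, z.1)) :
    Subgroup.closure {t₁, t₂, h} = Subgroup.closure {w, t₂, σ} := by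
  have hq0 : (q : ℝ) ≠ 0 := by exact_mod_cast hq.ne'
  have h_eq : h = w ^ p * σ := by
    ext z <;> simp only [Equiv.Perm.mul_apply, zpow_apply_of_translation hw, hh, hσ] <;> ring
  have h_sq : h * h = w ^ (2 * p) := by
    ext z <;> simp only [Equiv.Perm.mul_apply, zpow_apply_of_translation hw, hh] <;>
      push_cast <;> ring
  have w_pow : w ^ (q : ℤ) = t₁ * t₂ := by
    ext z <;> simp only [Equiv.Perm.mul_apply, zpow_apply_of_translation hw, ht₁, ht₂] <;>
      push_cast <;> field_simp
  have t₁_eq : t₁ = σ * t₂ * σ := by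
    ext z <;> simp only [Equiv.Perm.mul_apply, ht₁, ht₂, hσ]
  have hcop : IsCoprime (2 * p) (q : ℤ) := by
    refine IsCoprime.mul_left ?_ (Int.isCoprime_iff_gcd_eq_one.mpr hpq)
    exact_mod_cast Nat.isCoprime_iff_coprime.mpr hqo.coprime_two_left
  obtain ⟨a, b, hab⟩ := hcop
  have w_eq : w = (h * h) ^ a * (t₁ * t₂) ^ b := by
    rw [h_sq, ← w_pow, ← zpow_mul, ← zpow_mul, ← zpow_add, mul_comm (2 * p), mul_comm (q : ℤ),
      hab, zpow_one]
  apply le_antisymm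
  · have w_mem : w ∈ Subgroup.closure {w, t₂, σ} := Subgroup.subset_closure (by simp)
    have t₂_mem : t₂ ∈ Subgroup.closure {w, t₂, σ} := Subgroup.subset_closure (by simp)
    have σ_mem : σ ∈ Subgroup.closure {w, t₂, σ} := Subgroup.subset_closure (by simp)
    rw [Subgroup.closure_le]
    rintro _ (rfl | rfl | rfl)
    · rw [t₁_eq]
      exact mul_mem (mul_mem σ_mem t₂_mem) σ_mem
    · exact t₂_mem
    · rw [h_eq]
      exact mul_mem (zpow_mem w_mem p) σ_mem
  · have t₁_mem : t₁ ∈ Subgroup.closure {t₁, t₂, h} := Subgroup.subset_closure (by simp)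
    have t₂_mem : t₂ ∈ Subgroup.closure {t₁, t₂, h} := Subgroup.subset_closure (by simp)
    have h_mem : h ∈ Subgroup.closure {t₁, t₂, h} := Subgroup.subset_closure (by simp)
    have w_mem : w ∈ Subgroup.closure {t₁, t₂, h} := by
      rw [w_eq]
      exact mul_mem (zpow_mem (mul_mem h_mem h_mem) a) (zpow_mem (mul_mem t₁_mem t₂_mem) b)
    have σ_mem : σ ∈ Subgroup.closure {t₁, t₂, h} := by
      rw [eq_inv_mul_of_mul_eq h_eq.symm]
      exact mul_mem (inv_mem (zpow_mem w_mem p)) h_mem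
    rw [Subgroup.closure_le]
    rintro _ (rfl | rfl | rfl)
    exacts [w_mem, t₂_mem, σ_mem]
end
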